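/- arXiv:2209.13405 — 3 statements merged into one kernel-verified Lean document; each statement's English description precedes it below -/
import Mathlib

section
/- Under Assumption 1 (L = 1), for all z ∈ ℝ^{2d}: ‖∇Φ_t(z) − E_t‖ ≤ (t³/6)e^t in operator norm, where, writing (x_s, v_s) = Φ_s(z), E_t is the 2d×2d block matrix with blocks E_t = [[I_d − ∫₀ᵗ(t−s)∇²U(x_s)ds, −∫₀ᵗ∇²U(x_s)ds], [t·I_d, I_d − ∫₀ᵗ s∇²U(x_s)ds]]. In particular, for all z ∈ ℝ^{2d}: ‖∇_x Φ_t¹(z)‖ ≤ 1 + t²/2 + (t³/6)e^t, ‖∇_v Φ_t¹(z)‖ ≤ t + (t³/6)e^t, ‖∇_x Φ_t²(z)‖ ≤ t + (t³/6)e^t, and ‖∇_v Φ_t²(z)‖ ≤ 1 + t²/2 + (t³/6)e^t. -/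
open MeasureTheory Real Set

noncomputable section

abbrev Ed (d : ℕ) := EuclideanSpace ℝ (Fin d)
abbrev Phase (d : ℕ) := Ed d × Ed d

/-- Standard Gaussian measure `N(0, I_d)` on `ℝ^d`, defined by normalising the density
`exp (-‖v‖²/2)` with respect to the Lebesgue measure. -/
def stdGaussian (d : ℕ) : Measure (Ed d) :=
  ((volume.withDensity fun v : Ed d => ENNReal.ofReal (Real.exp (-‖v‖ ^ 2 / 2))) Set.univ)⁻¹ •
    volume.withDensity fun v : Ed d => ENNReal.ofReal (Real.exp (-‖v‖ ^ 2 / 2))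

/-- The probability measure with density proportional to `exp (-U)`. -/
def gibbs {d : ℕ} (U : Ed d → ℝ) : Measure (Ed d) :=
  ((volume.withDensity fun x => ENNReal.ofReal (Real.exp (-U x))) Set.univ)⁻¹ •
    volume.withDensity fun x => ENNReal.ofReal (Real.exp (-U x))

/-- The equilibrium measure `μ = π ⊗ N(0, I_d)` on phase space. -/
def eqMeasure {d : ℕ} (U : Ed d → ℝ) : Measure (Phase d) := (gibbs U).prod (stdGaussian d)

/-- Relative entropy `Ent(ν|μ) = ∫ ln (dν/dμ) dν`. -/
def relEnt {α : Type*} [MeasurableSpace α] (ν μ : Measure α) : ℝ :=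
  ∫ z, Real.log ((ν.rnDeriv μ z).toReal) ∂ν

/-- Gradient in the position variable. -/
def gradX {d : ℕ} (h : Phase d → ℝ) (z : Phase d) : Ed d := gradient (fun x => h (x, z.2)) z.1

/-- Gradient in the velocity variable. -/
def gradV {d : ℕ} (h : Phase d → ℝ) (z : Phase d) : Ed d := gradient (fun v => h (z.1, v)) z.2

/-- `h` is a (nonnegative, C¹) density of `ν` with respect to `μ` on phase space. -/
def IsDensityOf {d : ℕ} (h : Phase d → ℝ) (ν μ : Measure (Phase d)) : Prop :=
  (∀ z, 0 ≤ h z) ∧ ContDiff ℝ 1 h ∧ ν = μ.withDensity fun z => ENNReal.ofReal (h z)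

/-- `h` is a (nonnegative, C¹) density of `ν` with respect to `μ` on `ℝ^m`. -/
def IsDensityOfE {m : ℕ} (h : Ed m → ℝ) (ν μ : Measure (Ed m)) : Prop :=
  (∀ x, 0 ≤ h x) ∧ ContDiff ℝ 1 h ∧ ν = μ.withDensity fun x => ENNReal.ofReal (h x)

/-- Logarithmic Sobolev inequality with constant `C` for a measure on `ℝ^d`, in the
functional form `∫ g ln g dπ ≤ C ∫ |∇g|²/g dπ` over C¹ probability densities `g`. -/
def HasLSI {d : ℕ} (pm : Measure (Ed d)) (C : ℝ) : Prop :=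
  ∀ g : Ed d → ℝ, ContDiff ℝ 1 g → (∀ x, 0 ≤ g x) → (∫ x, g x ∂pm) = 1 →
    ∫ x, g x * Real.log (g x) ∂pm ≤ C * ∫ x, ‖gradient g x‖ ^ 2 / g x ∂pm

/-- `G`-Poincaré inequality with constant `C`:  `∫ G(g) dπ ≤ C ∫ G''(g)|∇g|² dπ`. -/
def HasGPoincare {d : ℕ} (pm : Measure (Ed d)) (G : ℝ → ℝ) (C : ℝ) : Prop :=
  ∀ g : Ed d → ℝ, ContDiff ℝ 1 g → (∀ x, 0 ≤ g x) → (∫ x, g x ∂pm) = 1 →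
    ∫ x, G (g x) ∂pm ≤ C * ∫ x, iteratedDeriv 2 G (g x) * ‖gradient g x‖ ^ 2 ∂pm

/-- One transition `ν ↦ νP` of the idealized HMC chain `P = D_η H_t`: the velocity is
refreshed (`v ↦ ηv + √(1-η²) G`) and then the Hamiltonian flow `Φ` is followed for time `t`. -/
def stepP {d : ℕ} (Φ : ℝ → Phase d → Phase d) (t η : ℝ) (ν : Measure (Phase d)) :
    Measure (Phase d) :=
  ν.bind fun z => (stdGaussian d).map fun g => Φ t (z.1, η • z.2 + Real.sqrt (1 - η ^ 2) • g)

/-- One transition `ν ↦ νQ` of the chain `Q = D_η H_t D_η`. -/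
def stepQ {d : ℕ} (Φ : ℝ → Phase d → Phase d) (t η : ℝ) (ν : Measure (Phase d)) :
    Measure (Phase d) :=
  ν.bind fun z => ((stdGaussian d).prod (stdGaussian d)).map fun gg =>
    ((Φ t (z.1, η • z.2 + Real.sqrt (1 - η ^ 2) • gg.1)).1,
      η • (Φ t (z.1, η • z.2 + Real.sqrt (1 - η ^ 2) • gg.1)).2 +
        Real.sqrt (1 - η ^ 2) • gg.2)

/-- One transition `ν ↦ νP_θ` of the HMC chain with random integration time `t ∼ θ`. -/
def stepPtheta {d : ℕ} (Φ : ℝ → Phase d → Phase d) (η : ℝ) (θ : Measure ℝ)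
    (ν : Measure (Phase d)) : Measure (Phase d) :=
  ν.bind fun z => θ.bind fun t =>
    (stdGaussian d).map fun g => Φ t (z.1, η • z.2 + Real.sqrt (1 - η ^ 2) • g)

/-- The modified entropy `L(ν) = Ent(ν|μ) + a ∫ |∇_x h + ∇_v h|²/h dμ`, expressed through a
density `h` of `ν` with respect to `μ`. -/
def modEnt {d : ℕ} (μ : Measure (Phase d)) (a : ℝ) (h : Phase d → ℝ) : ℝ :=
  (∫ z, h z * Real.log (h z) ∂μ) + a * ∫ z, ‖gradX h z + gradV h z‖ ^ 2 / h z ∂μ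

/-- The modified `G`-entropy `L_G(ν) = ∫ G(h) dμ + a ∫ G''(h)|∇_x h + ∇_v h|² dμ`. -/
def modEntG {d : ℕ} (μ : Measure (Phase d)) (G : ℝ → ℝ) (a : ℝ) (h : Phase d → ℝ) : ℝ :=
  (∫ z, G (h z) ∂μ) + a * ∫ z, iteratedDeriv 2 G (h z) * ‖gradX h z + gradV h z‖ ^ 2 ∂μ

/-- The `G`-Fisher information `I_G(ν|μ) = ∫ G''(h)|∇h|² dμ` on phase space. -/
def fisherG {d : ℕ} (μ : Measure (Phase d)) (G : ℝ → ℝ) (h : Phase d → ℝ) : ℝ :=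
  ∫ z, iteratedDeriv 2 G (h z) * (‖gradX h z‖ ^ 2 + ‖gradV h z‖ ^ 2) ∂μ

/-- Squared Euclidean norm `|z|² = |x|² + |v|²` on phase space. -/
def normSq {d : ℕ} (z : Phase d) : ℝ := ‖z.1‖ ^ 2 + ‖z.2‖ ^ 2

/-- Squared `L²` Wasserstein distance on phase space (Euclidean cost), as an infimum over
couplings. -/
def W2sq {d : ℕ} (ν μ' : Measure (Phase d)) : ℝ :=
  ⨅ r : {r : Measure (Phase d × Phase d) // r.map Prod.fst = ν ∧ r.map Prod.snd = μ'},
    ∫ p, normSq (p.1 - p.2) ∂(r : Measure (Phase d × Phase d))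

/-- Frobenius norm of a linear map on `ℝ^d`. -/
def frobNorm {d : ℕ} (A : Ed d →L[ℝ] Ed d) : ℝ :=
  Real.sqrt (∑ i, ∑ j, (A (EuclideanSpace.single j 1) i) ^ 2)

/-- Frobenius norm of a linear map on phase space. -/
def frobNormP {d : ℕ} (A : Phase d →L[ℝ] Phase d) : ℝ :=
  Real.sqrt ((∑ j, normSq (A (EuclideanSpace.single j 1, 0))) +
    ∑ j, normSq (A (0, EuclideanSpace.single j 1)))

/-- Block `2×2` continuous linear map on phase space. -/
def blockCLM {d : ℕ} (M11 M12 M21 M22 : Ed d →L[ℝ] Ed d) : Phase d →L[ℝ] Phase d :=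
  ((M11.comp (ContinuousLinearMap.fst ℝ (Ed d) (Ed d))) +
      (M12.comp (ContinuousLinearMap.snd ℝ (Ed d) (Ed d)))).prod
    ((M21.comp (ContinuousLinearMap.fst ℝ (Ed d) (Ed d))) +
      (M22.comp (ContinuousLinearMap.snd ℝ (Ed d) (Ed d))))

/-- One step of the HMC chain driven by the explicit noise `ω = (t, g)`. -/
def chainStep {d : ℕ} (Φ : ℝ → Phase d → Phase d) (η : ℝ) (ω : ℝ × Ed d) (z : Phase d) :
    Phase d :=
  Φ ω.1 (z.1, η • z.2 + Real.sqrt (1 - η ^ 2) • ω.2)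

/-- `n` steps of the HMC chain driven by the explicit noise sequence `ω`. -/
def chainIter {d : ℕ} (Φ : ℝ → Phase d → Phase d) (η : ℝ) :
    (n : ℕ) → (Fin n → ℝ × Ed d) → Phase d → Phase d
  | 0, _, z => z
  | n + 1, ω, z => chainIter Φ η n (fun i => ω i.succ) (chainStep Φ η (ω 0) z)

/-- The convergence rate `ρ` of Theorem 2.1 as a function of the parameters. -/
def rhoHMC (η a t : ℝ) : ℝ :=
  let m₁ := 2 * t - 21 / 10 * t ^ 2
  let m₂ := 1 + η * (-1 + 2 * t + 13 / 5 * t ^ 2)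
  let m₃ := 1 - η ^ 2 * (1 + 2 * t + 31 / 10 * t ^ 2) + (1 - η ^ 2) / (2 * a)
  if η = 0 then (1 - 3 * t) * (m₁ - 2 * a / (2 * a + 1))
  else (1 - 3 * t) * ((m₁ + m₃ * (η⁻¹) ^ 2) / 2 -
    Real.sqrt (m₂ ^ 2 * (η⁻¹) ^ 2 + ((m₁ - m₃ * (η⁻¹) ^ 2) / 2) ^ 2))

/-- The critical depth `c*` of the potential `U`: infimum, over continuous paths `Γ` going
from a local minimum of `U` to a global minimum of `U`, of the maximal elevation gain. -/
def critDepth {d : ℕ} (U : Ed d → ℝ) : ℝ :=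
  sInf {c : ℝ | ∃ Γ : ℝ → Ed d, ContinuousOn Γ (Set.Icc 0 1) ∧ IsLocalMin U (Γ 0) ∧
    (∀ y, U (Γ 1) ≤ U y) ∧ c = sSup ((fun s => U (Γ s)) '' Set.Icc 0 1) - U (Γ 0)}

/-- The function `D_η h` obtained from `h` by the velocity-refreshment operator. -/
def refreshFun {d : ℕ} (η : ℝ) (h : Phase d → ℝ) (z : Phase d) : ℝ :=
  ∫ g, h (z.1, η • z.2 + Real.sqrt (1 - η ^ 2) • g) ∂stdGaussian d

end

section LinearVariation

variable {E : Type*} [NormedAddCommGroup E] [NormedSpace ℝ E]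

/-- Existence of the resolvent of a linear ODE `ẏ = A y` with `‖A‖ ≤ 1` on a short interval. -/
theorem exists_linear_resolvent [CompleteSpace E] {A : ℝ → E →L[ℝ] E} (hA : Continuous A)
    (hA1 : ∀ s, ‖A s‖ ≤ 1) {T : ℝ} (hT0 : 0 ≤ T) (hT : T ≤ 1 / 4) :
    ∃ Y : ℝ → E →L[ℝ] E, Y 0 = ContinuousLinearMap.id ℝ E ∧
      ∀ s ∈ Icc 0 T, HasDerivWithinAt Y ((A s).comp (Y s)) (Icc 0 T) s := by
  have hPL : IsPicardLindelof (fun s (Y : E →L[ℝ] E) => (A s).comp Y)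
      (⟨0, left_mem_Icc.2 hT0⟩ : Icc 0 T) (ContinuousLinearMap.id ℝ E) 1 0 2 1 := by
    refine ⟨fun s _ => ?_, fun Y _ => ?_, fun s _ Y hY => ?_, ?_⟩
    · refine LipschitzWith.lipschitzOnWith (LipschitzWith.of_dist_le_mul fun Y Z => ?_)
      rw [dist_eq_norm, dist_eq_norm, ← ContinuousLinearMap.comp_sub]
      exact (ContinuousLinearMap.opNorm_comp_le _ _).trans
        (mul_le_mul_of_nonneg_right (by simpa using hA1 s) (norm_nonneg _))
    · exact (hA.clm_comp continuous_const).continuousOn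
    · have h1 : ‖Y‖ ≤ 2 := by
        have h2 : ‖Y - ContinuousLinearMap.id ℝ E‖ ≤ 1 := by
          simpa [dist_eq_norm] using hY
        have h3 := norm_le_norm_add_norm_sub' Y (ContinuousLinearMap.id ℝ E)
        have h4 : ‖ContinuousLinearMap.id ℝ E‖ ≤ 1 := ContinuousLinearMap.norm_id_le
        linarith
      calc ‖(A s).comp Y‖ ≤ ‖A s‖ * ‖Y‖ := ContinuousLinearMap.opNorm_comp_le _ _
        _ ≤ 1 * 2 := mul_le_mul (hA1 s) h1 (norm_nonneg _) zero_le_one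
        _ = _ := by norm_num
    · simp only [sub_zero, sub_self, max_eq_left hT0]
      push_cast
      linarith
  exact hPL.exists_eq_forall_mem_Icc_hasDerivWithinAt₀

theorem HasDerivWithinAt.Ici_of_Icc {f : ℝ → E} {f' : E} {a b s : ℝ}
    (h : HasDerivWithinAt f f' (Icc a b) s) (hs : s ∈ Ico a b) :
    HasDerivWithinAt f f' (Ici s) s :=
  h.mono_of_mem_nhdsWithin (Icc_mem_nhdsGE_of_mem hs)

/-- Differentiability in the initial condition of the flow of a `C¹` vector field with derivative
bounded by `1`; the derivative solves the linearised equation. -/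
theorem exists_hasFDerivAt_flow [CompleteSpace E] {f : E → E} {f' : E → E →L[ℝ] E}
    (hf : ∀ y, HasFDerivAt f (f' y) y) (hf'c : Continuous f') (hf'1 : ∀ y, ‖f' y‖ ≤ 1)
    {Φ : ℝ → E → E} (hΦ0 : ∀ z, Φ 0 z = z)
    (hΦ : ∀ z s, HasDerivAt (fun u => Φ u z) (f (Φ s z)) s)
    {T : ℝ} (hT0 : 0 ≤ T) (hT : T ≤ 1 / 4) (z : E) :
    ∃ Y : ℝ → E →L[ℝ] E, Y 0 = ContinuousLinearMap.id ℝ E ∧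
      (∀ s ∈ Icc 0 T, HasDerivWithinAt Y ((f' (Φ s z)).comp (Y s)) (Icc 0 T) s) ∧
      HasFDerivAt (Φ T) (Y T) z := by
  have hΦc : ∀ z, Continuous fun s => Φ s z := fun z =>
    continuous_iff_continuousAt.2 fun s => (hΦ z s).continuousAt
  obtain ⟨Y, hY0, hY⟩ := exists_linear_resolvent (A := fun s => f' (Φ s z))
    (hf'c.comp (hΦc z)) (fun s => hf'1 _) hT0 hT
  refine ⟨Y, hY0, hY, ?_⟩
  have hLip : LipschitzWith 1 f := lipschitzWith_of_nnnorm_fderiv_le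
    (fun y => (hf y).differentiableAt) fun y => by
      rw [(hf y).fderiv]; exact_mod_cast hf'1 y
  have hexpT : exp T ≤ 2 := by
    have := Real.exp_bound_div_one_sub_of_interval hT0 (by linarith)
    refine this.trans ?_
    rw [div_le_iff₀ (by linarith)]
    linarith
  have hdist : ∀ w, ∀ s ∈ Icc 0 T, ‖Φ s (z + w) - Φ s z‖ ≤ 2 * ‖w‖ := by
    intro w s hs
    have h := dist_le_of_trajectories_ODE (v := fun _ => f) (K := 1) (a := 0) (b := T)
      (f := fun s => Φ s (z + w)) (g := fun s => Φ s z) (δ := ‖w‖) (fun _ => hLip)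
      (hΦc _).continuousOn (fun s _ => (hΦ _ s).hasDerivWithinAt)
      (hΦc _).continuousOn (fun s _ => (hΦ _ s).hasDerivWithinAt)
      (by simp [hΦ0]) s hs
    rw [dist_eq_norm] at h
    refine h.trans ?_
    have h2 : exp (((1 : NNReal) : ℝ) * (s - 0)) ≤ 2 :=
      le_trans (Real.exp_le_exp.2 (by simpa using hs.2)) hexpT
    nlinarith [norm_nonneg w]
  rw [hasFDerivAt_iff_isLittleO_nhds_zero, Asymptotics.isLittleO_iff]
  intro c hc
  have hcompact : IsCompact ((fun s => Φ s z) '' Icc 0 T) :=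
    isCompact_Icc.image (hΦc z)
  have hunif := hcompact.uniformContinuousAt_of_continuousAt f'
    (fun a _ => hf'c.continuousAt) (Metric.dist_mem_uniformity (half_pos hc))
  obtain ⟨δ, hδ, hδ'⟩ := Metric.mem_uniformity_dist.1 hunif
  filter_upwards [Metric.ball_mem_nhds (0 : E) (show 0 < δ / 2 by positivity)] with w hw
  have hw' : 2 * ‖w‖ < δ := by
    rw [mem_ball_zero_iff] at hw
    linarith
  have hlin : ∀ s ∈ Icc 0 T,
      ‖f (Φ s (z + w)) - f (Φ s z) - f' (Φ s z) (Φ s (z + w) - Φ s z)‖ ≤ c * ‖w‖ := by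
    intro s hs
    have h := (convex_ball (Φ s z) δ).norm_image_sub_le_of_norm_hasFDerivWithin_le' (f := f)
      (f' := f') (φ := f' (Φ s z)) (C := c / 2) (x := Φ s z) (y := Φ s (z + w))
      (fun y _ => (hf y).hasFDerivWithinAt) (fun y hy => by
        have h1 : dist (f' (Φ s z)) (f' y) < c / 2 :=
          hδ' (a := Φ s z) (b := y) (by rwa [dist_comm]) (mem_image_of_mem _ hs)
        rw [← dist_eq_norm, dist_comm]
        exact h1.le) (Metric.mem_ball_self hδ)
      (by rw [Metric.mem_ball, dist_eq_norm]; exact (hdist w s hs).trans_lt hw')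
    refine h.trans ?_
    nlinarith [hdist w s hs]
  have hder : ∀ s ∈ Icc 0 T, HasDerivWithinAt (fun s => Φ s (z + w) - Φ s z - Y s w)
      (f (Φ s (z + w)) - f (Φ s z) - f' (Φ s z) (Y s w)) (Icc 0 T) s := fun s hs =>
    (((hΦ (z + w) s).sub (hΦ z s)).hasDerivWithinAt).sub
      (by simpa using (hY s hs).clm_apply (hasDerivWithinAt_const s _ w))
  have h := norm_le_gronwallBound_of_norm_deriv_right_le (K := 1) (ε := c * ‖w‖) (δ := 0)
    (fun s hs => (hder s hs).continuousWithinAt)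
    (fun s hs => (hder s (Ico_subset_Icc_self hs)).Ici_of_Icc hs)
    (by simp [hΦ0, hY0]) (fun s hs => by
      have hs' := Ico_subset_Icc_self hs
      have h1 : f (Φ s (z + w)) - f (Φ s z) - f' (Φ s z) (Y s w)
          = f' (Φ s z) (Φ s (z + w) - Φ s z - Y s w)
            + (f (Φ s (z + w)) - f (Φ s z) - f' (Φ s z) (Φ s (z + w) - Φ s z)) := by
        rw [map_sub (f' (Φ s z)) (Φ s (z + w) - Φ s z)]
        abel
      rw [h1]
      refine (norm_add_le _ _).trans (add_le_add ?_ (hlin s hs'))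
      exact (f' (Φ s z)).le_of_opNorm_le (hf'1 _) _) T (right_mem_Icc.2 hT0)
  refine h.trans ?_
  rw [gronwallBound_of_K_ne_0 one_ne_zero]
  have : c * ‖w‖ * (exp T - 1) ≤ c * ‖w‖ * 1 :=
    mul_le_mul_of_nonneg_left (by linarith) (by positivity)
  simpa using this

/-- Third order remainder of the Dyson series of a linear ODE `ẏ = A y` with `‖A‖ ≤ 1`. -/
theorem norm_sub_dyson_two_le {A : ℝ → E →L[ℝ] E} (hA : ∀ s, ‖A s‖ ≤ 1) {T : ℝ} (hT : 0 ≤ T)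
    {w : E} {y y₁ y₂ : ℝ → E} (hy0 : y 0 = w) (hy₁0 : y₁ 0 = w) (hy₂0 : y₂ 0 = w)
    (hy : ∀ s ∈ Icc 0 T, HasDerivWithinAt y (A s (y s)) (Icc 0 T) s)
    (hy₁ : ∀ s ∈ Icc 0 T, HasDerivWithinAt y₁ (A s w) (Icc 0 T) s)
    (hy₂ : ∀ s ∈ Icc 0 T, HasDerivWithinAt y₂ (A s (y₁ s)) (Icc 0 T) s) :
    ‖y T - y₂ T‖ ≤ T ^ 3 / 6 * exp T * ‖w‖ := by
  have hAle : ∀ s u, ‖A s u‖ ≤ ‖u‖ := fun s u => by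
    simpa using (A s).le_of_opNorm_le (hA s) u
  have key : ∀ (g g' : ℝ → E) (B B' : ℝ → ℝ), g 0 = 0 → 0 ≤ B 0 →
      (∀ s ∈ Icc 0 T, HasDerivWithinAt g (g' s) (Icc 0 T) s) → (∀ s, HasDerivAt B (B' s) s) →
      (∀ s ∈ Icc 0 T, ‖g' s‖ ≤ B' s) → ∀ s ∈ Icc 0 T, ‖g s‖ ≤ B s := by
    intro g g' B B' h0 hB0 hg hB hb s hs
    exact image_norm_le_of_norm_deriv_right_le_deriv_boundary
      (fun s hs => (hg s hs).continuousWithinAt)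
      (fun s hs => (hg s (Ico_subset_Icc_self hs)).Ici_of_Icc hs) (by simpa [h0] using hB0) hB
      (fun s hs => hb s (Ico_subset_Icc_self hs)) hs
  have b0 : ∀ s ∈ Icc 0 T, ‖y s‖ ≤ exp T * ‖w‖ := by
    intro s hs
    have h := norm_le_gronwallBound_of_norm_deriv_right_le (K := 1) (ε := 0) (δ := ‖w‖)
      (fun s hs => (hy s hs).continuousWithinAt)
      (fun s hs => (hy s (Ico_subset_Icc_self hs)).Ici_of_Icc hs) (by rw [hy0])
      (fun s _ => by simpa using hAle s (y s)) s hs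
    rw [gronwallBound_ε0, one_mul, sub_zero, mul_comm] at h
    exact h.trans (mul_le_mul_of_nonneg_right (exp_le_exp.2 hs.2) (norm_nonneg _))
  have b1 : ∀ s ∈ Icc 0 T, ‖y s - w‖ ≤ s * (exp T * ‖w‖) :=
    key (fun s => y s - w) (fun s => A s (y s)) _ _ (by simp [hy0]) (by simp)
      (fun s hs => (hy s hs).sub_const w) (fun s => (hasDerivAt_id s).mul_const _)
      (fun s hs => by simpa using (hAle s _).trans (b0 s hs))
  have b2 : ∀ s ∈ Icc 0 T, ‖y s - y₁ s‖ ≤ s ^ 2 / 2 * (exp T * ‖w‖) :=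
    key (fun s => y s - y₁ s) (fun s => A s (y s) - A s w) _
      (fun s => s * (exp T * ‖w‖)) (by simp [hy0, hy₁0]) (by simp)
      (fun s hs => (hy s hs).sub (hy₁ s hs))
      (fun s => (((hasDerivAt_pow 2 s).div_const 2).mul_const _).congr_deriv (by norm_num))
      (fun s hs => by rw [← map_sub]; exact (hAle s _).trans (b1 s hs))
  have b3 : ∀ s ∈ Icc 0 T, ‖y s - y₂ s‖ ≤ s ^ 3 / 6 * (exp T * ‖w‖) :=
    key (fun s => y s - y₂ s) (fun s => A s (y s) - A s (y₁ s)) _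
      (fun s => s ^ 2 / 2 * (exp T * ‖w‖)) (by simp [hy0, hy₂0]) (by simp)
      (fun s hs => (hy s hs).sub (hy₂ s hs))
      (fun s => (((hasDerivAt_pow 3 s).div_const 6).mul_const _).congr_deriv (by
        push_cast; ring))
      (fun s hs => by rw [← map_sub]; exact (hAle s _).trans (b2 s hs))
  simpa [mul_assoc] using b3 T (right_mem_Icc.2 hT)

/-- The linearised Hamiltonian field `(a, b) ↦ (b, -H a)`. -/
def hamField (H : E →L[ℝ] E) : E × E →L[ℝ] E × E :=
  (ContinuousLinearMap.snd ℝ E E).prod (-(H.comp (ContinuousLinearMap.fst ℝ E E)))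

theorem hamField_apply (H : E →L[ℝ] E) (w : E × E) : hamField H w = (w.2, -H w.1) := rfl

theorem continuous_hamField : Continuous (hamField : (E →L[ℝ] E) → E × E →L[ℝ] E × E) :=
  (ContinuousLinearMap.prodₗᵢ ℝ).continuous.comp
    (continuous_const.prodMk (continuous_id.clm_comp continuous_const).neg)

theorem norm_hamField_le {H : E →L[ℝ] E} (hH : ‖H‖ ≤ 1) : ‖hamField H‖ ≤ 1 := by
  refine ContinuousLinearMap.opNorm_le_bound _ zero_le_one fun w => ?_
  rw [hamField_apply, one_mul, Prod.norm_mk, norm_neg]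
  exact max_le (norm_snd_le w)
    (((H.le_of_opNorm_le hH _).trans_eq (one_mul _)).trans (norm_fst_le w))

/-- The field `hamField H` on the `L²` product. -/
def hamFieldL2 (H : E →L[ℝ] E) : WithLp 2 (E × E) →L[ℝ] WithLp 2 (E × E) :=
  ((WithLp.prodContinuousLinearEquiv 2 ℝ E E).symm : E × E →L[ℝ] WithLp 2 (E × E)).comp
    ((hamField H).comp (WithLp.prodContinuousLinearEquiv 2 ℝ E E : _ →L[ℝ] E × E))

theorem norm_hamFieldL2_le {H : E →L[ℝ] E} (hH : ‖H‖ ≤ 1) : ‖hamFieldL2 H‖ ≤ 1 := by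
  refine ContinuousLinearMap.opNorm_le_bound _ zero_le_one fun w => ?_
  rw [one_mul, WithLp.prod_norm_eq_of_L2, WithLp.prod_norm_eq_of_L2]
  refine Real.sqrt_le_sqrt ?_
  change ‖w.snd‖ ^ 2 + ‖-H w.fst‖ ^ 2 ≤ _
  rw [norm_neg, add_comm]
  gcongr
  exact (H.le_of_opNorm_le hH _).trans_eq (one_mul _)

theorem HasDerivWithinAt.toLp_two {y : ℝ → E × E} {y' : E × E} {S : Set ℝ} {s : ℝ}
    (h : HasDerivWithinAt y y' S s) :
    HasDerivWithinAt (fun u => WithLp.toLp 2 (y u)) (WithLp.toLp 2 y') S s :=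
  ((WithLp.prodContinuousLinearEquiv 2 ℝ E E).symm :
    E × E →L[ℝ] WithLp 2 (E × E)).hasFDerivAt.comp_hasDerivWithinAt s h

/-- Second order Dyson approximation of the linearised Hamiltonian flow, in Euclidean norm. -/
theorem sqrt_normSq_sub_dyson_le [CompleteSpace E] {H : ℝ → E →L[ℝ] E} (hH : Continuous H)
    (hH1 : ∀ s, ‖H s‖ ≤ 1) {T : ℝ} (hT : 0 ≤ T) {w : E × E} {y : ℝ → E × E} (hy0 : y 0 = w)
    (hy : ∀ s ∈ Icc 0 T, HasDerivWithinAt y ((y s).2, -H s (y s).1) (Icc 0 T) s) :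
    ‖WithLp.toLp 2 (y T - (w.1 - (∫ s in (0 : ℝ)..T, (T - s) • H s) w.1 + T • w.2,
      -((∫ s in (0 : ℝ)..T, H s) w.1) + w.2 - (∫ s in (0 : ℝ)..T, s • H s) w.2))‖ ≤
      T ^ 3 / 6 * exp T * ‖WithLp.toLp 2 w‖ := by
  have hsH : Continuous fun s => s • H s := continuous_id.smul hH
  have d0 : ∀ s (v : E), HasDerivAt (fun r => (∫ u in (0 : ℝ)..r, H u) v) (H s v) s := fun s v => by
    simpa using (hH.integral_hasStrictDerivAt 0 s).hasDerivAt.clm_apply (hasDerivAt_const s v)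
  have d1 : ∀ s (v : E), HasDerivAt (fun r => (∫ u in (0 : ℝ)..r, u • H u) v) (s • H s v) s :=
    fun s v => by
      simpa using (hsH.integral_hasStrictDerivAt 0 s).hasDerivAt.clm_apply (hasDerivAt_const s v)
  have hsplit : ∀ r : ℝ, ∫ s in (0 : ℝ)..r, (r - s) • H s =
      r • (∫ s in (0 : ℝ)..r, H s) - ∫ s in (0 : ℝ)..r, s • H s := fun r => by
    simp_rw [sub_smul]
    rw [intervalIntegral.integral_sub, intervalIntegral.integral_smul]
    · exact (hH.const_smul r).intervalIntegrable _ _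
    · exact hsH.intervalIntegrable _ _
  have hid : ∀ s (v : E), HasDerivAt (fun r : ℝ => r • v) v s := fun s v => by
    simpa using (hasDerivAt_id s).smul_const v
  have h := norm_sub_dyson_two_le (A := fun s => hamFieldL2 (H s)) (w := WithLp.toLp 2 w)
    (y := fun s => WithLp.toLp 2 (y s))
    (y₁ := fun s => WithLp.toLp 2 (w.1 + s • w.2, w.2 - (∫ u in (0 : ℝ)..s, H u) w.1))
    (y₂ := fun s => WithLp.toLp 2
      (w.1 - (s • (∫ u in (0 : ℝ)..s, H u) w.1 - (∫ u in (0 : ℝ)..s, u • H u) w.1) + s • w.2,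
        -((∫ u in (0 : ℝ)..s, H u) w.1) + w.2 - (∫ u in (0 : ℝ)..s, u • H u) w.2))
    (fun s => norm_hamFieldL2_le (hH1 s)) hT (by rw [hy0]) (by simp) (by simp)
    (fun s hs => (hy s hs).toLp_two)
    (fun s _ => ((((hid s w.2).const_add w.1).prodMk
      ((d0 s w.1).const_sub w.2)).hasDerivWithinAt).toLp_two)
    (fun s _ => by
      have h1 := ((((hasDerivAt_id s).smul (d0 s w.1)).sub (d1 s w.1)).const_sub w.1).add
        (hid s w.2)
      have h2 := ((d0 s w.1).neg.add_const w.2).sub (d1 s w.2)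
      refine ((h1.prodMk h2).congr_deriv (?_ :
        _ = (w.2 - (∫ u in (0 : ℝ)..s, H u) w.1, -H s (w.1 + s • w.2)))).hasDerivWithinAt.toLp_two
      ext1
      · simp [sub_eq_neg_add]
      · simp [sub_eq_add_neg, add_comm])
  rw [hsplit]
  simpa only [← WithLp.toLp_sub, sub_apply, smul_apply]
    using h

theorem norm_integral_sub_smul_le {H : ℝ → E →L[ℝ] E} (hH1 : ∀ s, ‖H s‖ ≤ 1) {T : ℝ}
    (hT : 0 ≤ T) : ‖∫ s in (0 : ℝ)..T, (T - s) • H s‖ ≤ T ^ 2 / 2 := by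
  refine (intervalIntegral.norm_integral_le_of_norm_le hT (g := fun s => T - s)
    (.of_forall fun s hs => ?_) (Continuous.intervalIntegrable (by fun_prop) 0 T)).trans_eq ?_
  · rw [norm_smul, Real.norm_of_nonneg (by linarith [hs.2])]
    exact mul_le_of_le_one_right (by linarith [hs.2]) (hH1 s)
  · rw [intervalIntegral.integral_sub (by simp) (by simp)]
    simp
    ring

theorem norm_integral_smul_le {H : ℝ → E →L[ℝ] E} (hH1 : ∀ s, ‖H s‖ ≤ 1) {T : ℝ}
    (hT : 0 ≤ T) : ‖∫ s in (0 : ℝ)..T, s • H s‖ ≤ T ^ 2 / 2 := by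
  refine (intervalIntegral.norm_integral_le_of_norm_le hT (g := fun s => s)
    (.of_forall fun s hs => ?_) (Continuous.intervalIntegrable (by fun_prop) 0 T)).trans_eq ?_
  · rw [norm_smul, Real.norm_of_nonneg hs.1.le]
    exact mul_le_of_le_one_right hs.1.le (hH1 s)
  · simp

theorem norm_integral_le_self {H : ℝ → E →L[ℝ] E} (hH1 : ∀ s, ‖H s‖ ≤ 1) {T : ℝ}
    (hT : 0 ≤ T) : ‖∫ s in (0 : ℝ)..T, H s‖ ≤ T := by
  simpa [abs_of_nonneg hT] using
    intervalIntegral.norm_integral_le_of_norm_le_const (a := 0) (b := T) fun s _ => hH1 s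

end LinearVariation

theorem sqrt_normSq_eq_norm_toLp {d : ℕ} (z : Phase d) :
    Real.sqrt (normSq z) = ‖WithLp.toLp 2 z‖ :=
  (WithLp.prod_norm_eq_of_L2 _).symm

theorem ContDiff.gradient_one {F : Type*} [NormedAddCommGroup F] [InnerProductSpace ℝ F]
    [CompleteSpace F] {U : F → ℝ} (hU : ContDiff ℝ 2 U) : ContDiff ℝ 1 (gradient U) :=
  (InnerProductSpace.toDual ℝ F).symm.contDiff.comp
    (hU.fderiv_right (m := 1) (by norm_num))

/-- Lemma 4.1, first part: the Jacobian of the Hamiltonian flow is close (in Euclidean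
operator norm) to the explicit block matrix `E_t`, with the resulting bounds on the four
blocks of the Jacobian. -/
theorem hamiltonian_flow_jacobian_bounds
    {d : ℕ} (hd : 1 ≤ d) (U : Ed d → ℝ) (hU : ContDiff ℝ 2 U)
    (hHess : ∀ x, ‖fderiv ℝ (gradient U) x‖ ≤ 1)
    (t : ℝ) (ht0 : 0 < t) (ht : t ≤ 1 / 4)
    (Φ : ℝ → Phase d → Phase d)
    (hΦ0 : ∀ z, Φ 0 z = z)
    (hΦ : ∀ z s, HasDerivAt (fun u => Φ u z) ((Φ s z).2, -gradient U (Φ s z).1) s) :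
    (∀ z w : Phase d,
      Real.sqrt (normSq
          (fderiv ℝ (Φ t) z w -
            (w.1 - (∫ s in (0 : ℝ)..t, (t - s) • fderiv ℝ (gradient U) (Φ s z).1) w.1
                + t • w.2,
              -((∫ s in (0 : ℝ)..t, fderiv ℝ (gradient U) (Φ s z).1) w.1) + w.2
                - (∫ s in (0 : ℝ)..t, s • fderiv ℝ (gradient U) (Φ s z).1) w.2))) ≤
        t ^ 3 / 6 * Real.exp t * Real.sqrt (normSq w)) ∧
    (∀ z : Phase d,
      ‖fderiv ℝ (fun x => (Φ t (x, z.2)).1) z.1‖ ≤ 1 + t ^ 2 / 2 + t ^ 3 / 6 * Real.exp t) ∧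
    (∀ z : Phase d,
      ‖fderiv ℝ (fun v => (Φ t (z.1, v)).1) z.2‖ ≤ t + t ^ 3 / 6 * Real.exp t) ∧
    (∀ z : Phase d,
      ‖fderiv ℝ (fun x => (Φ t (x, z.2)).2) z.1‖ ≤ t + t ^ 3 / 6 * Real.exp t) ∧
    (∀ z : Phase d,
      ‖fderiv ℝ (fun v => (Φ t (z.1, v)).2) z.2‖ ≤ 1 + t ^ 2 / 2 + t ^ 3 / 6 * Real.exp t) := by
  have hg := hU.gradient_one
  have hgc : Continuous (fderiv ℝ (gradient U)) := hg.continuous_fderiv one_ne_zero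
  have hΦc : ∀ z, Continuous fun s => Φ s z := fun z =>
    continuous_iff_continuousAt.2 fun s => (hΦ z s).continuousAt
  have hflow := fun z => exists_hasFDerivAt_flow
    (f := fun z : Phase d => (z.2, -gradient U z.1))
    (f' := fun z => hamField (fderiv ℝ (gradient U) z.1))
    (fun z => hasFDerivAt_snd.prodMk
      (((hg.differentiable one_ne_zero z.1).hasFDerivAt.comp z hasFDerivAt_fst).neg))
    (continuous_hamField.comp (hgc.comp continuous_fst))
    (fun z => norm_hamField_le (hHess z.1)) hΦ0 hΦ ht0.le ht z
  have hdiff : ∀ z, HasFDerivAt (Φ t) (fderiv ℝ (Φ t) z) z := fun z => by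
    obtain ⟨Y, -, -, hY⟩ := hflow z
    exact hY.differentiableAt.hasFDerivAt
  have hleft : ∀ z : Phase d, HasFDerivAt (fun x => Φ t (x, z.2))
      ((fderiv ℝ (Φ t) z).comp (.inl ℝ (Ed d) (Ed d))) z.1 := fun z =>
    HasFDerivAt.comp (g := Φ t) (f := fun x => (x, z.2)) z.1 (hdiff z)
      (hasFDerivAt_prodMk_left z.1 z.2)
  have hright : ∀ z : Phase d, HasFDerivAt (fun v => Φ t (z.1, v))
      ((fderiv ℝ (Φ t) z).comp (.inr ℝ (Ed d) (Ed d))) z.2 := fun z =>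
    HasFDerivAt.comp (g := Φ t) (f := fun v => (z.1, v)) z.2 (hdiff z)
      (hasFDerivAt_prodMk_right z.1 z.2)
  have hmain : ∀ z w : Phase d,
      Real.sqrt (normSq
          (fderiv ℝ (Φ t) z w -
            (w.1 - (∫ s in (0 : ℝ)..t, (t - s) • fderiv ℝ (gradient U) (Φ s z).1) w.1
                + t • w.2,
              -((∫ s in (0 : ℝ)..t, fderiv ℝ (gradient U) (Φ s z).1) w.1) + w.2
                - (∫ s in (0 : ℝ)..t, s • fderiv ℝ (gradient U) (Φ s z).1) w.2))) ≤
        t ^ 3 / 6 * Real.exp t * Real.sqrt (normSq w) := by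
    intro z w
    obtain ⟨Y, hY0, hY, hYt⟩ := hflow z
    rw [hYt.fderiv, sqrt_normSq_eq_norm_toLp, sqrt_normSq_eq_norm_toLp]
    exact sqrt_normSq_sub_dyson_le (H := fun s => fderiv ℝ (gradient U) (Φ s z).1)
      (y := fun s => Y s w) (hgc.comp (hΦc z).fst) (fun s => hHess _) ht0.le (by simp [hY0])
      (fun s hs => by
        simpa [hamField_apply] using (hY s hs).clm_apply (hasDerivWithinAt_const s _ w))
  have hfst : ∀ {D : Phase d} {c : ℝ}, Real.sqrt (normSq D) ≤ c → ‖D.1‖ ≤ c := fun h =>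
    (Real.le_sqrt_of_sq_le (le_add_of_nonneg_right (sq_nonneg _))).trans h
  have hsnd : ∀ {D : Phase d} {c : ℝ}, Real.sqrt (normSq D) ≤ c → ‖D.2‖ ≤ c := fun h =>
    (Real.le_sqrt_of_sq_le (le_add_of_nonneg_left (sq_nonneg _))).trans h
  have hblock : ∀ {J M : Ed d →L[ℝ] Ed d} {b : ℝ}, ‖M‖ ≤ b →
      (∀ a, ‖J a - M a‖ ≤ t ^ 3 / 6 * Real.exp t * ‖a‖) →
      ‖J‖ ≤ b + t ^ 3 / 6 * Real.exp t := by
    intro J M b hM hJ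
    have h : ‖J - M‖ ≤ t ^ 3 / 6 * Real.exp t :=
      ContinuousLinearMap.opNorm_le_bound _ (by positivity) hJ
    linarith [norm_le_norm_add_norm_sub' J M]
  have hid : ‖ContinuousLinearMap.id ℝ (Ed d)‖ ≤ 1 := ContinuousLinearMap.norm_id_le
  refine ⟨hmain, fun z => ?_, fun z => ?_, fun z => ?_, fun z => ?_⟩
  · have hd1 := hasFDerivAt_fst.comp z.1 (hleft z)
    rw [HasFDerivAt.fderiv (f := fun x => (Φ t (x, z.2)).1) hd1]
    refine hblock (M := .id ℝ _ -
      ∫ s in (0 : ℝ)..t, (t - s) • fderiv ℝ (gradient U) (Φ s z).1) ?_ fun a => ?_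
    · exact (norm_sub_le _ _).trans
        (add_le_add hid (norm_integral_sub_smul_le (fun s => hHess _) ht0.le))
    · simpa [normSq] using hfst (hmain z (a, 0))
  · have hd1 := hasFDerivAt_fst.comp z.2 (hright z)
    rw [HasFDerivAt.fderiv (f := fun v => (Φ t (z.1, v)).1) hd1]
    refine hblock (M := t • .id ℝ _) ?_ fun a => ?_
    · rw [norm_smul, Real.norm_of_nonneg ht0.le]
      exact mul_le_of_le_one_right ht0.le hid
    · simpa [normSq] using hfst (hmain z (0, a))
  · have hd1 := hasFDerivAt_snd.comp z.1 (hleft z)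
    rw [HasFDerivAt.fderiv (f := fun x => (Φ t (x, z.2)).2) hd1]
    refine hblock (M := -∫ s in (0 : ℝ)..t, fderiv ℝ (gradient U) (Φ s z).1) ?_ fun a => ?_
    · rw [norm_neg]
      exact norm_integral_le_self (fun s => hHess _) ht0.le
    · simpa [normSq] using hsnd (hmain z (a, 0))
  · have hd1 := hasFDerivAt_snd.comp z.2 (hright z)
    rw [HasFDerivAt.fderiv (f := fun v => (Φ t (z.1, v)).2) hd1]
    refine hblock (M := .id ℝ _ -
      ∫ s in (0 : ℝ)..t, s • fderiv ℝ (gradient U) (Φ s z).1) ?_ fun a => ?_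
    · exact (norm_sub_le _ _).trans
        (add_le_add hid (norm_integral_smul_le (fun s => hHess _) ht0.le))
    · simpa [normSq] using hsnd (hmain z (0, a))
end

section
/- Under Assumption 1 (L = 1), for all z = (x,v), z' = (x',v') ∈ ℝ^{2d}: |Φ_t¹(z) − Φ_t¹(z')| ≤ (1 + t²/2 + (t³/6)e^t)|x − x'| + (t + (t³/6)e^t)|v − v'|, and |Φ_t²(z) − Φ_t²(z')| ≤ (t + (t³/6)e^t)|x − x'| + (1 + t²/2 + (t³/6)e^t)|v − v'|. -/
open MeasureTheory Real Set

/-- A curve on `[0, ∞)` whose speed is bounded by `B'` and which starts in the ball of radius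
`B 0` stays in the ball of radius `B s` at time `s`. -/
lemma norm_le_of_norm_deriv_le_deriv {E : Type*} [NormedAddCommGroup E] [NormedSpace ℝ E]
    {f f' : ℝ → E} {B B' : ℝ → ℝ} (hf : ∀ s, HasDerivAt f (f' s) s)
    (hB : ∀ s, HasDerivAt B (B' s) s) (h0 : ‖f 0‖ ≤ B 0) (h : ∀ s, 0 ≤ s → ‖f' s‖ ≤ B' s)
    {s : ℝ} (hs : 0 ≤ s) : ‖f s‖ ≤ B s :=
  image_norm_le_of_norm_deriv_right_le_deriv_boundary
    (fun u _ => (hf u).continuousAt.continuousWithinAt) (fun u _ => (hf u).hasDerivWithinAt)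
    h0 hB (fun u hu => h u hu.1) (right_mem_Icc.2 hs)

lemma hasDerivAt_exp_sub_one (s : ℝ) : HasDerivAt (fun u => Real.exp u - 1) (Real.exp s) s :=
  (Real.hasDerivAt_exp s).sub_const 1

lemma hasDerivAt_exp_sub_one_sub_id (s : ℝ) :
    HasDerivAt (fun u => Real.exp u - 1 - u) (Real.exp s - 1) s :=
  (hasDerivAt_exp_sub_one s).sub (hasDerivAt_id s)

lemma hasDerivAt_sq_div_two (s : ℝ) : HasDerivAt (fun u : ℝ => u ^ 2 / 2) s s := by
  simpa using (hasDerivAt_pow 2 s).div_const 2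

lemma hasDerivAt_exp_sub_quadratic (s : ℝ) :
    HasDerivAt (fun u => Real.exp u - 1 - u - u ^ 2 / 2) (Real.exp s - 1 - s) s :=
  (hasDerivAt_exp_sub_one_sub_id s).sub (hasDerivAt_sq_div_two s)

/-- Taylor remainder of order two of the exponential. -/
lemma exp_sub_quadratic_le {s : ℝ} (hs : 0 ≤ s) :
    Real.exp s - 1 - s - s ^ 2 / 2 ≤ s ^ 3 / 6 * Real.exp s := by
  have h1 : ∀ u : ℝ, 0 ≤ u → ‖Real.exp u - 1‖ ≤ u * Real.exp u := fun u hu =>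
    norm_le_of_norm_deriv_le_deriv hasDerivAt_exp_sub_one
      (fun r => (hasDerivAt_id r).mul (Real.hasDerivAt_exp r)) (by simp)
      (fun r hr => by
        rw [Real.norm_of_nonneg (Real.exp_pos r).le]
        have := mul_nonneg hr (Real.exp_pos r).le
        simp only [id]
        linarith) hu
  have h2 : ∀ u : ℝ, 0 ≤ u → ‖Real.exp u - 1 - u‖ ≤ u ^ 2 / 2 * Real.exp u := fun u hu =>
    norm_le_of_norm_deriv_le_deriv hasDerivAt_exp_sub_one_sub_id
      (fun r => (hasDerivAt_sq_div_two r).mul (Real.hasDerivAt_exp r)) (by simp)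
      (fun r hr => (h1 r hr).trans (le_add_of_nonneg_right (by positivity))) hu
  have hd : ∀ r : ℝ, HasDerivAt (fun u : ℝ => u ^ 3 / 6) (r ^ 2 / 2) r := fun r => by
    refine ((hasDerivAt_pow 3 r).div_const 6).congr_deriv ?_
    push_cast
    ring
  exact (le_abs_self _).trans (norm_le_of_norm_deriv_le_deriv hasDerivAt_exp_sub_quadratic
    (fun r => (hd r).mul (Real.hasDerivAt_exp r)) (by simp)
    (fun r hr => (h2 r hr).trans (le_add_of_nonneg_right (by positivity))) hs)

/-- If `q' = p` and `‖p'‖ ≤ ‖q‖`, then `q` and `p` grow at most as the second-order Taylor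
polynomials of the hyperbolic functions, up to a cubic remainder. -/
lemma norm_le_of_second_order {E : Type*} [NormedAddCommGroup E] [NormedSpace ℝ E]
    {q p g : ℝ → E} (hq : ∀ s, HasDerivAt q (p s) s) (hp : ∀ s, HasDerivAt p (g s) s)
    (hg : ∀ s, ‖g s‖ ≤ ‖q s‖) {t : ℝ} (ht : 0 ≤ t) :
    ‖q t‖ ≤ (1 + t ^ 2 / 2 + t ^ 3 / 6 * Real.exp t) * ‖q 0‖ +
        (t + t ^ 3 / 6 * Real.exp t) * ‖p 0‖ ∧
      ‖p t‖ ≤ (t + t ^ 3 / 6 * Real.exp t) * ‖q 0‖ +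
        (1 + t ^ 2 / 2 + t ^ 3 / 6 * Real.exp t) * ‖p 0‖ := by
  set a := ‖q 0‖ with ha
  set b := ‖p 0‖ with hb
  have ha0 : 0 ≤ a := norm_nonneg _
  have hb0 : 0 ≤ b := norm_nonneg _
  have hqp : ∀ s, HasDerivAt (fun u => (q u, p u)) (p s, g s) s := fun s => (hq s).prodMk (hp s)
  have h0 : ∀ s, 0 ≤ s → ‖(q s, p s)‖ ≤ (a + b) * Real.exp s := by
    intro s hs
    have := norm_le_gronwallBound_of_norm_deriv_right_le (f := fun u => (q u, p u))
      (f' := fun u => (p u, g u)) (δ := a + b) (K := 1) (ε := 0) (a := 0) (b := s)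
      (fun u _ => (hqp u).continuousAt.continuousWithinAt)
      (fun u _ => (hqp u).hasDerivWithinAt)
      (by rw [Prod.norm_def]; exact max_le (le_add_of_nonneg_right hb0)
            (le_add_of_nonneg_left ha0))
      (fun u _ => by
        rw [Prod.norm_def, Prod.norm_def, one_mul, add_zero, max_comm]
        exact max_le_max_right _ (hg u))
      s (right_mem_Icc.2 hs)
    simpa [gronwallBound_ε0] using this
  -- Each integration of the previous bounds gains one order in the Taylor expansion.
  have h1 : ∀ s, 0 ≤ s → ‖q s‖ ≤ a + (a + b) * (Real.exp s - 1) ∧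
      ‖p s‖ ≤ b + (a + b) * (Real.exp s - 1) := fun s hs =>
    have hB := fun c r => ((hasDerivAt_exp_sub_one r).const_mul (a + b)).const_add c
    ⟨norm_le_of_norm_deriv_le_deriv hq (hB a) (by simp [ha])
        (fun r hr => (norm_snd_le _).trans (h0 r hr)) hs,
      norm_le_of_norm_deriv_le_deriv hp (hB b) (by simp [hb])
        (fun r hr => (hg r).trans ((norm_fst_le _).trans (h0 r hr))) hs⟩
  have h2 : ∀ s, 0 ≤ s → ‖q s‖ ≤ a + b * s + (a + b) * (Real.exp s - 1 - s) ∧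
      ‖p s‖ ≤ b + a * s + (a + b) * (Real.exp s - 1 - s) := fun s hs =>
    have hB := fun c e r => (((hasDerivAt_id r).const_mul e).const_add c).add
      ((hasDerivAt_exp_sub_one_sub_id r).const_mul (a + b))
    ⟨norm_le_of_norm_deriv_le_deriv hq (hB a b) (by simp [ha])
        (fun r hr => (h1 r hr).2.trans_eq (by ring)) hs,
      norm_le_of_norm_deriv_le_deriv hp (hB b a) (by simp [hb])
        (fun r hr => (hg r).trans ((h1 r hr).1.trans_eq (by ring))) hs⟩
  have hB := fun c e r => ((((hasDerivAt_id r).const_mul e).const_add c).add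
    ((hasDerivAt_sq_div_two r).const_mul c)).add
      ((hasDerivAt_exp_sub_quadratic r).const_mul (a + b))
  have hq3 : ‖q t‖ ≤ a + b * t + a * (t ^ 2 / 2) +
      (a + b) * (Real.exp t - 1 - t - t ^ 2 / 2) :=
    norm_le_of_norm_deriv_le_deriv hq (hB a b) (by simp [ha])
      (fun r hr => (h2 r hr).2.trans_eq (by ring)) ht
  have hp3 : ‖p t‖ ≤ b + a * t + b * (t ^ 2 / 2) +
      (a + b) * (Real.exp t - 1 - t - t ^ 2 / 2) :=
    norm_le_of_norm_deriv_le_deriv hp (hB b a) (by simp [hb])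
      (fun r hr => (hg r).trans ((h2 r hr).1.trans_eq (by ring))) ht
  have hR := mul_le_mul_of_nonneg_left (exp_sub_quadratic_le ht) (add_nonneg ha0 hb0)
  constructor <;> linarith

/-- The gradient of a `C²` function with Hessian bounded by one is nonexpansive. -/
lemma norm_gradient_sub_le {E : Type*} [NormedAddCommGroup E] [InnerProductSpace ℝ E]
    [CompleteSpace E] {U : E → ℝ} (hU : ContDiff ℝ 2 U)
    (hHess : ∀ x, ‖fderiv ℝ (gradient U) x‖ ≤ 1) (x y : E) :
    ‖gradient U x - gradient U y‖ ≤ ‖x - y‖ := by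
  have hdiff : Differentiable ℝ (gradient U) :=
    (InnerProductSpace.toDual ℝ E).symm.toContinuousLinearEquiv.differentiable.comp
      ((hU.fderiv_right (m := 1) le_rfl).differentiable one_ne_zero)
  simpa using convex_univ.norm_image_sub_le_of_norm_fderiv_le (𝕜 := ℝ)
    (fun z _ => hdiff z) (fun z _ => hHess z) (mem_univ y) (mem_univ x)

/-- Lemma 4.1, Lipschitz bounds for the two components of the Hamiltonian flow. -/
theorem hamiltonian_flow_lipschitz_bounds
    {d : ℕ} (hd : 1 ≤ d) (U : Ed d → ℝ) (hU : ContDiff ℝ 2 U)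
    (hHess : ∀ x, ‖fderiv ℝ (gradient U) x‖ ≤ 1)
    (t : ℝ) (ht0 : 0 < t) (ht : t ≤ 1 / 4)
    (Φ : ℝ → Phase d → Phase d)
    (hΦ0 : ∀ z, Φ 0 z = z)
    (hΦ : ∀ z s, HasDerivAt (fun u => Φ u z) ((Φ s z).2, -gradient U (Φ s z).1) s) :
    ∀ x v x' v' : Ed d,
      ‖(Φ t (x, v)).1 - (Φ t (x', v')).1‖ ≤
        (1 + t ^ 2 / 2 + t ^ 3 / 6 * Real.exp t) * ‖x - x'‖ +
          (t + t ^ 3 / 6 * Real.exp t) * ‖v - v'‖ ∧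
      ‖(Φ t (x, v)).2 - (Φ t (x', v')).2‖ ≤
        (t + t ^ 3 / 6 * Real.exp t) * ‖x - x'‖ +
          (1 + t ^ 2 / 2 + t ^ 3 / 6 * Real.exp t) * ‖v - v'‖ := by
  intro x v x' v'
  have hdiff : ∀ s, HasDerivAt (fun u => Φ u (x, v) - Φ u (x', v'))
      ((Φ s (x, v)).2 - (Φ s (x', v')).2,
        -gradient U (Φ s (x, v)).1 - -gradient U (Φ s (x', v')).1) s :=
    fun s => (hΦ (x, v) s).sub (hΦ (x', v') s)
  have key := norm_le_of_second_order
    (q := fun s => (Φ s (x, v)).1 - (Φ s (x', v')).1)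
    (p := fun s => (Φ s (x, v)).2 - (Φ s (x', v')).2)
    (fun s => (hdiff s).fst) (fun s => (hdiff s).snd)
    (fun s => by
      rw [neg_sub_neg, norm_sub_rev]
      exact norm_gradient_sub_le hU hHess _ _) ht0.le
  simpa only [hΦ0] using key
end

section
/- Under Assumptions 1 and 2 with L = 1: there exists a function K ∈ C¹(ℝ^{2d}, ℝ^d) such that for all x, x' ∈ ℝ^d, v = K(x,x') is the unique solution of Φ_t¹(x, K(x,x')) = x'. Moreover, defining for u₀, u₁ ∈ ℝ^d the function K_{u₀,u₁}(x,v) = K(x + u₀, Φ_t¹(x,v) + u₁) (so that v' = K_{u₀,u₁}(x,v) is the unique solution of Φ_t¹(x+u₀, v') = Φ_t¹(x,v) + u₁), for all x, v, u₀, u₁ ∈ ℝ^d: |u₁ − u₀ + tv − t·K_{u₀,u₁}(x,v)| ≤ (3/5)t²|u₀| + (1/5)t²|u₁ − u₀|. -/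
open MeasureTheory Real Set

/-- Integrating a polynomial bound on the second derivative of a curve twice. -/
lemma norm_sub_sub_smul_le_of_second_deriv {E : Type*} [NormedAddCommGroup E] [NormedSpace ℝ E]
    {y p a : ℝ → E} (hy : ∀ s, HasDerivAt y (p s) s) (hp : ∀ s, HasDerivAt p (a s) s)
    {t A B C : ℝ} (ha : ∀ s ∈ Icc 0 t, ‖a s‖ ≤ A + B * s + C * s ^ 2) :
    ∀ s ∈ Icc 0 t,
      ‖y s - y 0 - s • p 0‖ ≤ A * s ^ 2 / 2 + B * s ^ 3 / 6 + C * s ^ 4 / 12 := by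
  have h1 : ∀ s ∈ Icc 0 t, ‖p s - p 0‖ ≤ A * s + B * s ^ 2 / 2 + C * s ^ 3 / 3 := by
    have hd : ∀ s, HasDerivAt (fun s => p s - p 0) (a s) s := fun s => (hp s).sub_const _
    refine image_norm_le_of_norm_deriv_right_le_deriv_boundary
      (f' := a) (B' := fun s => A + B * s + C * s ^ 2)
      (fun s _ => (hd s).continuousAt.continuousWithinAt)
      (fun s _ => (hd s).hasDerivWithinAt) (by simp) (fun s => ?_)
      (fun s hs => ha s (Ico_subset_Icc_self hs))
    have := (((hasDerivAt_id s).const_mul A).add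
      ((((hasDerivAt_id s).pow 2).const_mul B).div_const 2)).add
      ((((hasDerivAt_id s).pow 3).const_mul C).div_const 3)
    refine this.congr_deriv ?_
    simp
    ring
  have hd : ∀ s, HasDerivAt (fun s => y s - y 0 - s • p 0) (p s - p 0) s := fun s => by
    have := ((hy s).sub_const (y 0)).sub ((hasDerivAt_id s).smul_const (p 0))
    rwa [one_smul] at this
  refine image_norm_le_of_norm_deriv_right_le_deriv_boundary
    (f' := fun s => p s - p 0) (B' := fun s => A * s + B * s ^ 2 / 2 + C * s ^ 3 / 3)
    (fun s _ => (hd s).continuousAt.continuousWithinAt)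
    (fun s _ => (hd s).hasDerivWithinAt) (by simp) (fun s => ?_)
    (fun s hs => h1 s (Ico_subset_Icc_self hs))
  have := (((((hasDerivAt_id s).pow 2).const_mul A).div_const 2).add
    ((((hasDerivAt_id s).pow 3).const_mul B).div_const 6)).add
    ((((hasDerivAt_id s).pow 4).const_mul C).div_const 12)
  refine this.congr_deriv ?_
  simp
  ring

/-- A priori bound for a curve whose acceleration is controlled by its position. -/
lemma exists_sup_bound_of_second_deriv {E : Type*} [NormedAddCommGroup E] [NormedSpace ℝ E]
    {y p a : ℝ → E} (hy : ∀ s, HasDerivAt y (p s) s) (hp : ∀ s, HasDerivAt p (a s) s)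
    {t c : ℝ} (ht : 0 ≤ t) (hc : 0 ≤ c) (ha : ∀ s ∈ Icc 0 t, ‖a s‖ ≤ ‖y s‖ + c) :
    ∃ M, 0 ≤ M ∧ (∀ s ∈ Icc 0 t, ‖y s‖ ≤ M) ∧
      (∀ s ∈ Icc 0 t, ‖y s - y 0 - s • p 0‖ ≤ s ^ 2 / 2 * (M + c)) ∧
      M ≤ ‖y 0‖ + t * ‖p 0‖ + t ^ 2 / 2 * (M + c) := by
  have hcont : Continuous y := continuous_iff_continuousAt.2 fun s => (hy s).continuousAt
  obtain ⟨s₀, hs₀, hmax⟩ := isCompact_Icc.exists_isMaxOn (nonempty_Icc.2 ht)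
    hcont.norm.continuousOn
  have hM : ∀ s ∈ Icc 0 t, ‖y s‖ ≤ ‖y s₀‖ := fun s hs => hmax hs
  have hT : ∀ s ∈ Icc 0 t, ‖y s - y 0 - s • p 0‖ ≤ s ^ 2 / 2 * (‖y s₀‖ + c) := by
    intro s hs
    have := norm_sub_sub_smul_le_of_second_deriv hy hp (A := ‖y s₀‖ + c) (B := 0) (C := 0)
      (fun s hs => by linarith [ha s hs, hM s hs]) s hs
    linarith
  refine ⟨‖y s₀‖, norm_nonneg _, hM, hT, ?_⟩
  have h1 := hT s₀ hs₀
  have h2 : ‖y s₀‖ ≤ ‖y s₀ - y 0 - s₀ • p 0‖ + (‖y 0‖ + ‖s₀ • p 0‖) := by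
    have : y s₀ = (y s₀ - y 0 - s₀ • p 0) + (y 0 + s₀ • p 0) := by abel
    calc ‖y s₀‖ = ‖(y s₀ - y 0 - s₀ • p 0) + (y 0 + s₀ • p 0)‖ := by rw [← this]
      _ ≤ _ := (norm_add_le _ _).trans (by gcongr; exact norm_add_le _ _)
  rw [norm_smul, Real.norm_of_nonneg hs₀.1] at h2
  have h3 : s₀ * ‖p 0‖ ≤ t * ‖p 0‖ := by gcongr; exact hs₀.2
  have h4 : s₀ ^ 2 / 2 * (‖y s₀‖ + c) ≤ t ^ 2 / 2 * (‖y s₀‖ + c) := by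
    gcongr
    · exact hs₀.1
    · exact hs₀.2
  linarith

/-- The end-point estimate for a curve whose acceleration is bounded by its position. -/
lemma norm_endpoint_sub_le {E : Type*} [NormedAddCommGroup E] [NormedSpace ℝ E]
    {y p a : ℝ → E} (hy : ∀ s, HasDerivAt y (p s) s) (hp : ∀ s, HasDerivAt p (a s) s)
    {t : ℝ} (ht0 : 0 ≤ t) (ht : t ≤ 1 / 4) (ha : ∀ s, ‖a s‖ ≤ ‖y s‖) :
    ‖y t - y 0 - t • p 0‖ ≤ 3 / 5 * t ^ 2 * ‖y 0‖ + 1 / 5 * t ^ 2 * ‖y t - y 0‖ := by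
  obtain ⟨M, hM0, hM, hT, hMle⟩ := exists_sup_bound_of_second_deriv hy hp ht0 le_rfl
    (fun s _ => by simpa using ha s)
  have hpos : ∀ s ∈ Icc 0 t, ‖y s‖ ≤ ‖y 0‖ + ‖p 0‖ * s + M / 2 * s ^ 2 := by
    intro s hs
    have h1 := hT s hs
    have h2 : ‖y s‖ ≤ ‖y s - y 0 - s • p 0‖ + (‖y 0‖ + ‖s • p 0‖) := by
      have : y s = (y s - y 0 - s • p 0) + (y 0 + s • p 0) := by abel
      calc ‖y s‖ = ‖(y s - y 0 - s • p 0) + (y 0 + s • p 0)‖ := by rw [← this]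
        _ ≤ _ := (norm_add_le _ _).trans (by gcongr; exact norm_add_le _ _)
    rw [norm_smul, Real.norm_of_nonneg hs.1] at h2
    linarith
  have hR := norm_sub_sub_smul_le_of_second_deriv hy hp
    (fun s hs => (ha s).trans (hpos s hs)) t ⟨ht0, le_rfl⟩
  have hw : t * ‖p 0‖ ≤ ‖y t - y 0‖ + ‖y t - y 0 - t • p 0‖ := by
    have : ‖t • p 0‖ ≤ ‖y t - y 0‖ + ‖y t - y 0 - t • p 0‖ := by
      have e : t • p 0 = (y t - y 0) - (y t - y 0 - t • p 0) := by abel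
      calc ‖t • p 0‖ = ‖(y t - y 0) - (y t - y 0 - t • p 0)‖ := by rw [← e]
        _ ≤ _ := norm_sub_le _ _
    rwa [norm_smul, Real.norm_of_nonneg ht0] at this
  set R := ‖y t - y 0 - t • p 0‖
  set D := ‖y t - y 0‖
  have hD : 0 ≤ D := norm_nonneg _
  have hR0 : 0 ≤ R := norm_nonneg _
  have hu : 0 ≤ ‖y 0‖ := norm_nonneg _
  set u := ‖y 0‖
  set W := t * ‖p 0‖ with hW
  have ht2 : t ^ 2 ≤ 1 / 16 := by nlinarith
  have hM' : M ≤ 32 / 31 * (u + W) := by nlinarith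
  have hR' : R ≤ t ^ 2 * (u / 2 + W / 6 + M / 384) := by
    have h : t ^ 2 * (t ^ 2 * M) ≤ t ^ 2 * (1 / 16 * M) := by gcongr
    rw [hW]
    nlinarith
  have hR'' : R ≤ t ^ 2 * (51 / 100 * u + 17 / 100 * (D + R)) := by
    exact hR'.trans (mul_le_mul_of_nonneg_left (by linarith) (sq_nonneg t))
  have hRR : t ^ 2 * R ≤ 1 / 16 * R := by gcongr
  have hu2 : 0 ≤ t ^ 2 * u := by positivity
  have hD2 : 0 ≤ t ^ 2 * D := by positivity
  nlinarith

/-- A Lipschitz map on a finite-dimensional space whose second differences are bilinearly bounded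
is continuously differentiable. -/
lemma contDiff_one_of_norm_second_difference_le {E F : Type*}
    [NormedAddCommGroup E] [NormedSpace ℝ E] [FiniteDimensional ℝ E]
    [NormedAddCommGroup F] [NormedSpace ℝ F] [FiniteDimensional ℝ F]
    {f : E → F} {k : NNReal} (hf : LipschitzWith k f) {C : ℝ} (hC : 0 ≤ C)
    (h2 : ∀ z a b, ‖f (z + a + b) - f (z + a) - f (z + b) + f z‖ ≤ C * ‖a‖ * ‖b‖) :
    ContDiff ℝ 1 f := by
  have hdense : Dense {z | DifferentiableAt ℝ f z} := by
    borelize E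
    let μ : Measure E := MeasureTheory.Measure.addHaar
    exact MeasureTheory.Measure.dense_of_ae (μ := μ) hf.ae_differentiableAt
  have hLip : ∀ z ∈ {z | DifferentiableAt ℝ f z}, ∀ z' ∈ {z | DifferentiableAt ℝ f z},
      ‖fderiv ℝ f z - fderiv ℝ f z'‖ ≤ C * ‖z - z'‖ := by
    intro z hz z' hz'
    have hg : HasFDerivAt (fun w => f (w + (z - z')) - f w)
        (fderiv ℝ f z - fderiv ℝ f z') z' := by
      refine HasFDerivAt.sub ?_ hz'.hasFDerivAt
      have : HasFDerivAt f (fderiv ℝ f z) (z' + (z - z')) := by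
        simpa using hz.hasFDerivAt
      exact (hasFDerivAt_comp_add_right (z - z')).2 this
    refine hg.le_of_lip' (by positivity) (Filter.Eventually.of_forall fun w => ?_)
    have := h2 z' (z - z') (w - z')
    convert this using 2
    have e : z' + (z - z') + (w - z') = w + (z - z') := by abel
    have e' : z' + (w - z') = w := by abel
    rw [e, e']
    abel
  have hdiff : Differentiable ℝ f := by
    intro z₀
    obtain ⟨u, hu, hlim⟩ := mem_closure_iff_seq_limit.1 (hdense z₀)
    have hcauchy : CauchySeq fun n => fderiv ℝ f (u n) := by
      rw [Metric.cauchySeq_iff]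
      intro ε hε
      obtain ⟨N, hN⟩ := Metric.cauchySeq_iff.1 hlim.cauchySeq (ε / (C + 1)) (by positivity)
      refine ⟨N, fun m hm n hn => ?_⟩
      have h := hN m hm n hn
      rw [dist_eq_norm] at h ⊢
      rw [lt_div_iff₀ (by positivity)] at h
      have := hLip _ (hu m) _ (hu n)
      nlinarith [norm_nonneg (u m - u n)]
    obtain ⟨A, hA⟩ := cauchySeq_tendsto_of_complete hcauchy
    refine ⟨A, ?_⟩
    rw [hasFDerivAt_iff_isLittleO_nhds_zero, Asymptotics.isLittleO_iff]
    intro ε hε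
    obtain ⟨n, hn1, hn2⟩ : ∃ n, C * ‖u n - z₀‖ < ε / 3 ∧ ‖fderiv ℝ f (u n) - A‖ < ε / 3 := by
      have l1 : Filter.Tendsto (fun n => C * ‖u n - z₀‖) Filter.atTop (nhds 0) := by
        simpa using (tendsto_iff_norm_sub_tendsto_zero.1 hlim).const_mul C
      have l2 := tendsto_iff_norm_sub_tendsto_zero.1 hA
      exact ((l1.eventually_lt_const (by positivity : (0 : ℝ) < ε / 3)).and
        (l2.eventually_lt_const (by positivity : (0 : ℝ) < ε / 3))).exists
    have hd := (hasFDerivAt_iff_isLittleO_nhds_zero.1 (hu n).hasFDerivAt).def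
      (by positivity : 0 < ε / 3)
    filter_upwards [hd] with w hw
    have e : f (z₀ + w) - f z₀ - A w =
        -(f (z₀ + (u n - z₀) + w) - f (z₀ + (u n - z₀)) - f (z₀ + w) + f z₀)
        + (f (u n + w) - f (u n) - fderiv ℝ f (u n) w) + (fderiv ℝ f (u n) - A) w := by
      simp only [add_sub_cancel, sub_apply]
      abel
    have b1 := h2 z₀ (u n - z₀) w
    have b2 := (fderiv ℝ f (u n) - A).le_opNorm w
    rw [e]
    refine (norm_add₃_le).trans ?_
    rw [norm_neg]
    have c1 : C * ‖u n - z₀‖ * ‖w‖ ≤ ε / 3 * ‖w‖ := by gcongr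
    have c2 : ‖fderiv ℝ f (u n) - A‖ * ‖w‖ ≤ ε / 3 * ‖w‖ := by gcongr
    linarith
  refine contDiff_one_iff_fderiv.2 ⟨hdiff, ?_⟩
  refine (LipschitzWith.of_dist_le_mul (K := C.toNNReal) fun z z' => ?_).continuous
  rw [dist_eq_norm, dist_eq_norm, Real.coe_toNNReal _ hC]
  exact hLip z (hdiff z) z' (hdiff z')

lemma norm_le_frobNorm {d : ℕ} (A : Ed d →L[ℝ] Ed d) : ‖A‖ ≤ frobNorm A := by
  refine A.opNorm_le_bound (Real.sqrt_nonneg _) fun x => ?_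
  have hx : ∀ i, A x i = ∑ j, A (EuclideanSpace.single j 1) i * x j := by
    intro i
    have e : x = ∑ j, x j • EuclideanSpace.single j (1 : ℝ) := by
      simpa using ((EuclideanSpace.basisFun (Fin d) ℝ).sum_repr x).symm
    conv_lhs => rw [e]
    simp [map_sum, mul_comm]
  rw [EuclideanSpace.norm_eq, EuclideanSpace.norm_eq, frobNorm, ← Real.sqrt_mul (by positivity)]
  refine Real.sqrt_le_sqrt ?_
  simp only [Real.norm_eq_abs, sq_abs]
  rw [Finset.sum_mul]
  refine Finset.sum_le_sum fun i _ => ?_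
  rw [hx i]
  exact Finset.sum_mul_sq_le_sq_mul_sq _ _ _

/-- Second differences of a map with Lipschitz derivative. -/
lemma norm_second_difference_le {E F : Type*} [NormedAddCommGroup E] [NormedSpace ℝ E]
    [NormedAddCommGroup F] [NormedSpace ℝ F] {g : E → F} (hg : Differentiable ℝ g) {L : ℝ}
    (hL : ∀ x x', ‖fderiv ℝ g x - fderiv ℝ g x'‖ ≤ L * ‖x - x'‖) (z a b : E) :
    ‖g (z + a + b) - g (z + a) - g (z + b) + g z‖ ≤ L * ‖a‖ * ‖b‖ := by
  have hd : ∀ w, HasFDerivAt (fun w => g (w + a) - g w)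
      (fderiv ℝ g (w + a) - fderiv ℝ g w) w := fun w =>
    ((hasFDerivAt_comp_add_right a).2 (hg (w + a)).hasFDerivAt).sub (hg w).hasFDerivAt
  have := convex_univ.norm_image_sub_le_of_norm_hasFDerivWithin_le
    (C := L * ‖a‖) (fun w _ => (hd w).hasFDerivWithinAt)
    (fun w _ => by simpa using hL (w + a) w) (mem_univ z) (mem_univ (z + b))
  rw [add_sub_cancel_left] at this
  convert this using 2
  rw [add_right_comm]
  abel

/-- The position at time `t` determines the initial velocity for the Newton flow of a
`1`-Lipschitz force. -/
lemma exists_velocity_of_flow {E : Type*} [NormedAddCommGroup E] [NormedSpace ℝ E]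
    [CompleteSpace E] {G : E → E} (hG : ∀ x x', ‖G x - G x'‖ ≤ ‖x - x'‖)
    {t : ℝ} (ht0 : 0 < t) (ht : t ≤ 1 / 4) {q p : E × E → ℝ → E}
    (hq0 : ∀ z, q z 0 = z.1) (hp0 : ∀ z, p z 0 = z.2)
    (hq : ∀ z s, HasDerivAt (q z) (p z s) s) (hp : ∀ z s, HasDerivAt (p z) (-G (q z s)) s)
    (x x' : E) : ∃ v, q (x, v) t = x' := by
  have hlip : ∀ v v', ‖q (x, v) t - q (x, v') t - t • (v - v')‖ ≤ t * (1 / 2 * ‖v - v'‖) := by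
    intro v v'
    obtain ⟨M, hM0, -, hT, hMle⟩ := exists_sup_bound_of_second_deriv
      (y := fun s => q (x, v) s - q (x, v') s) (p := fun s => p (x, v) s - p (x, v') s)
      (fun s => (hq (x, v) s).sub (hq (x, v') s)) (fun s => (hp (x, v) s).sub (hp (x, v') s))
      ht0.le le_rfl (fun s _ => by
        rw [neg_sub_neg, norm_sub_rev, add_zero]
        exact hG _ _)
    have := hT t ⟨ht0.le, le_rfl⟩
    simp only [hq0, hp0, sub_self, sub_zero, norm_zero, add_zero, zero_add] at this hMle
    have ht2 : t ^ 2 ≤ 1 / 16 := by nlinarith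
    have hM' : M ≤ 2 * (t * ‖v - v'‖) := by nlinarith
    have hw : 0 ≤ t * ‖v - v'‖ := by positivity
    nlinarith
  have hcontr : ContractingWith (1 / 2) fun v => v - t⁻¹ • (q (x, v) t - x') := by
    refine ⟨by norm_num, LipschitzWith.of_dist_le_mul fun v v' => ?_⟩
    rw [dist_eq_norm, dist_eq_norm]
    have e : v - t⁻¹ • (q (x, v) t - x') - (v' - t⁻¹ • (q (x, v') t - x')) =
        -(t⁻¹ • (q (x, v) t - q (x, v') t - t • (v - v'))) := by
      rw [smul_sub t⁻¹ (_ - _) (t • _), inv_smul_smul₀ ht0.ne']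
      simp only [smul_sub]
      abel
    rw [e, norm_neg, norm_smul, norm_inv, Real.norm_of_nonneg ht0.le, inv_mul_le_iff₀ ht0]
    simpa using hlip v v'
  refine ⟨hcontr.fixedPoint, ?_⟩
  have h : hcontr.fixedPoint - t⁻¹ • (q (x, hcontr.fixedPoint) t - x') = hcontr.fixedPoint :=
    hcontr.fixedPoint_isFixedPt
  rw [sub_eq_self, smul_eq_zero] at h
  exact sub_eq_zero.1 (h.resolve_left (inv_ne_zero ht0.ne'))

/-- Bound on a curve with given end points whose acceleration is controlled by its position. -/
lemma norm_le_of_endpoints {E : Type*} [NormedAddCommGroup E] [NormedSpace ℝ E]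
    {y p a : ℝ → E} (hy : ∀ s, HasDerivAt y (p s) s) (hp : ∀ s, HasDerivAt p (a s) s)
    {t c N : ℝ} (ht0 : 0 ≤ t) (ht : t ≤ 1 / 4) (hc : 0 ≤ c)
    (ha : ∀ s ∈ Icc 0 t, ‖a s‖ ≤ ‖y s‖ + c) (h0 : ‖y 0‖ ≤ N) (h1 : ‖y t‖ ≤ N) :
    (∀ s ∈ Icc 0 t, ‖y s‖ ≤ 4 * N + c) ∧ t * ‖p 0‖ ≤ 4 * N + c := by
  obtain ⟨M, hM0, hM, hT, hMle⟩ := exists_sup_bound_of_second_deriv hy hp ht0 hc ha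
  have hR := hT t ⟨ht0, le_rfl⟩
  have hw : t * ‖p 0‖ ≤ ‖y t‖ + ‖y 0‖ + ‖y t - y 0 - t • p 0‖ := by
    have : ‖t • p 0‖ ≤ ‖y t‖ + ‖y 0‖ + ‖y t - y 0 - t • p 0‖ := by
      have e : t • p 0 = (y t - y 0) - (y t - y 0 - t • p 0) := by abel
      calc ‖t • p 0‖ = ‖(y t - y 0) - (y t - y 0 - t • p 0)‖ := by rw [← e]
        _ ≤ _ := (norm_sub_le _ _).trans (by gcongr; exact norm_sub_le _ _)
    rwa [norm_smul, Real.norm_of_nonneg ht0] at this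
  have ht2 : t ^ 2 ≤ 1 / 16 := by nlinarith
  have hN : 0 ≤ N := (norm_nonneg _).trans h0
  have hMc : t ^ 2 / 2 * (M + c) ≤ 1 / 16 / 2 * (M + c) := by gcongr
  refine ⟨fun s hs => (hM s hs).trans ?_, ?_⟩ <;> linarith

/-- Lemma 4.2, first part: existence of the C¹ map `K` such that `v = K(x,x')` is the unique
velocity for which the Hamiltonian flow sends `(x,v)` to a point with position `x'` in time
`t`, together with the basic estimate on `K_{u₀,u₁}(x,v) = K(x+u₀, Φ_t¹(x,v)+u₁)`. -/
theorem hamiltonian_flow_K_exists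
    {d : ℕ} (hd : 1 ≤ d) (U : Ed d → ℝ) (hU : ContDiff ℝ 2 U)
    (hHess : ∀ x, ‖fderiv ℝ (gradient U) x‖ ≤ 1)
    (LH : ℝ)
    (hHessLip : ∀ x x' : Ed d,
      frobNorm (fderiv ℝ (gradient U) x - fderiv ℝ (gradient U) x') ≤ LH * ‖x - x'‖)
    (t : ℝ) (ht0 : 0 < t) (ht : t ≤ 1 / 4)
    (Φ : ℝ → Phase d → Phase d)
    (hΦ0 : ∀ z, Φ 0 z = z)
    (hΦ : ∀ z s, HasDerivAt (fun u => Φ u z) ((Φ s z).2, -gradient U (Φ s z).1) s) :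
    ∃ K : Phase d → Ed d, ContDiff ℝ 1 K ∧
      (∀ x x' : Ed d,
        (Φ t (x, K (x, x'))).1 = x' ∧ ∀ v : Ed d, (Φ t (x, v)).1 = x' → v = K (x, x')) ∧
      ∀ x v u₀ u₁ : Ed d,
        ‖u₁ - u₀ + t • v - t • K (x + u₀, (Φ t (x, v)).1 + u₁)‖ ≤
          3 / 5 * t ^ 2 * ‖u₀‖ + 1 / 5 * t ^ 2 * ‖u₁ - u₀‖ := by
  have hgrad : Differentiable ℝ (gradient U) := by
    have h1 : Differentiable ℝ (fderiv ℝ U) :=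
      (hU.fderiv_right (m := 1) (by norm_num)).differentiable (by norm_num)
    exact (InnerProductSpace.toDual ℝ (Ed d)).symm.toContinuousLinearEquiv.differentiable.comp h1
  have hG : ∀ x x', ‖gradient U x - gradient U x'‖ ≤ ‖x - x'‖ := fun x x' => by
    simpa using convex_univ.norm_image_sub_le_of_norm_fderiv_le (fun w _ => hgrad w)
      (fun w _ => hHess w) (mem_univ x') (mem_univ x)
  have hG2 := norm_second_difference_le hgrad (L := |LH|) fun x x' =>
    (norm_le_frobNorm _).trans ((hHessLip x x').trans (by gcongr; exact le_abs_self _))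
  set G := gradient U
  let q : Phase d → ℝ → Ed d := fun z s => (Φ s z).1
  let p : Phase d → ℝ → Ed d := fun z s => (Φ s z).2
  have hq0 : ∀ z, q z 0 = z.1 := fun z => by simp [q, hΦ0]
  have hp0 : ∀ z, p z 0 = z.2 := fun z => by simp [p, hΦ0]
  have hq : ∀ z s, HasDerivAt (q z) (p z s) s := fun z s => (hΦ z s).fst
  have hp : ∀ z s, HasDerivAt (p z) (-G (q z s)) s := fun z s => (hΦ z s).snd
  have hacc : ∀ z z' s, ‖-G (q z s) - -G (q z' s)‖ ≤ ‖q z s - q z' s‖ := fun z z' s => by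
    rw [neg_sub_neg, norm_sub_rev]
    exact hG _ _
  have hest : ∀ z z', ‖q z t - q z' t - (z.1 - z'.1) - t • (z.2 - z'.2)‖ ≤
      3 / 5 * t ^ 2 * ‖z.1 - z'.1‖ +
        1 / 5 * t ^ 2 * ‖q z t - q z' t - (z.1 - z'.1)‖ := fun z z' => by
    have := norm_endpoint_sub_le (fun s => (hq z s).sub (hq z' s))
      (fun s => (hp z s).sub (hp z' s)) ht0.le ht (hacc z z')
    simpa only [Pi.sub_apply, hq0, hp0] using this
  choose k hk using exists_velocity_of_flow hG ht0 ht hq0 hp0 hq hp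
  let Q : Phase d → ℝ → Ed d := fun w => q (w.1, k w.1 w.2)
  let P : Phase d → ℝ → Ed d := fun w => p (w.1, k w.1 w.2)
  have hQ0 : ∀ w, Q w 0 = w.1 := fun w => hq0 _
  have hQt : ∀ w, Q w t = w.2 := fun w => hk _ _
  have hP0 : ∀ w, P w 0 = k w.1 w.2 := fun w => hp0 _
  have hQ : ∀ w s, HasDerivAt (Q w) (P w s) s := fun w => hq _
  have hP : ∀ w s, HasDerivAt (P w) (-G (Q w s)) s := fun w => hp _
  have hends := fun w w' => norm_le_of_endpoints (fun s => (hQ w s).sub (hQ w' s))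
    (fun s => (hP w s).sub (hP w' s)) ht0.le ht le_rfl (N := ‖w - w'‖)
    (fun s _ => (hacc _ _ s).trans (by simp [Q]))
    (by simpa only [Pi.sub_apply, hQ0, Prod.fst_sub] using norm_fst_le (w - w'))
    (by simpa only [Pi.sub_apply, hQt, Prod.snd_sub] using norm_snd_le (w - w'))
  have hKlip : LipschitzWith (4 / t).toNNReal fun w : Phase d => k w.1 w.2 := by
    refine LipschitzWith.of_dist_le_mul fun w w' => ?_
    rw [dist_eq_norm, dist_eq_norm, Real.coe_toNNReal _ (by positivity)]
    have := (hends w w').2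
    simp only [hP0, add_zero] at this
    rw [div_mul_eq_mul_div, le_div_iff₀ ht0]
    linarith
  refine ⟨fun w => k w.1 w.2, ?_, fun x x' => ⟨hk x x', fun v hv => ?_⟩, fun x v u₀ u₁ => ?_⟩
  · refine contDiff_one_of_norm_second_difference_le hKlip
      (C := |LH| * 16 / t) (by positivity) fun z a b => ?_
    have key := norm_le_of_endpoints
      (fun s => (((hQ (z + a + b) s).sub (hQ (z + a) s)).sub (hQ (z + b) s)).add (hQ z s))
      (fun s => (((hP (z + a + b) s).sub (hP (z + a) s)).sub (hP (z + b) s)).add (hP z s))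
      ht0.le ht (c := |LH| * (4 * ‖a‖) * (4 * ‖b‖)) (N := 0) (by positivity) (fun s hs => ?_)
      (by simp [hQ0]) (by simp [hQt])
    · have := key.2
      simp only [hP0] at this
      rw [div_mul_eq_mul_div, div_mul_eq_mul_div, le_div_iff₀ ht0]
      linarith
    · have ha := (hends (z + a) z).1 s hs
      have hb := (hends (z + b) z).1 s hs
      simp only [Pi.sub_apply, add_sub_cancel_left, add_zero] at ha hb
      have h2 := hG2 (Q z s) (Q (z + a) s - Q z s) (Q (z + b) s - Q z s)
      have h1 := hG (Q (z + a + b) s)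
        (Q z s + (Q (z + a) s - Q z s) + (Q (z + b) s - Q z s))
      have h2' := h2.trans (show _ ≤ |LH| * (4 * ‖a‖) * (4 * ‖b‖) by gcongr)
      simp only [Pi.sub_apply, Pi.add_apply]
      have e1 : -G (Q (z + a + b) s) - -G (Q (z + a) s) - -G (Q (z + b) s) + -G (Q z s) =
          -((G (Q (z + a + b) s) -
            G (Q z s + (Q (z + a) s - Q z s) + (Q (z + b) s - Q z s))) +
          (G (Q z s + (Q (z + a) s - Q z s) + (Q (z + b) s - Q z s)) -
            G (Q z s + (Q (z + a) s - Q z s)) - G (Q z s + (Q (z + b) s - Q z s)) +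
            G (Q z s))) := by
        simp only [add_sub_cancel]
        abel
      have e2 : Q (z + a + b) s - (Q z s + (Q (z + a) s - Q z s) + (Q (z + b) s - Q z s)) =
          Q (z + a + b) s - Q (z + a) s - Q (z + b) s + Q z s := by abel
      rw [e2] at h1
      rw [e1, norm_neg]
      exact (norm_add_le _ _).trans (add_le_add h1 h2')
  · have h := hest (x, v) (x, k x x')
    have hv' : q (x, v) t = x' := hv
    rw [hk, hv'] at h
    simp only [sub_self, norm_zero, mul_zero, add_zero, zero_sub, norm_neg, norm_le_zero_iff,
      smul_eq_zero] at h
    exact sub_eq_zero.1 (h.resolve_left ht0.ne')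
  · have h := hest (x + u₀, k (x + u₀) (q (x, v) t + u₁)) (x, v)
    rw [hk] at h
    simp only [add_sub_cancel_left] at h
    convert h using 2
    rw [smul_sub]
    abel
end
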